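/- The concept language L(∃,⊓,⊤,⊥) admits finite characterisations under DL-Lite ontologies:) for every DL-Lite ontology O, every finite signature Σ_C, Σ_R, and every concept C ∈ L(∃,⊓,⊤,⊥)[Σ_C,Σ_R], there exists a finite characterisation of C w.r.t. L(∃,⊓,⊤,⊥)[Σ_C,Σ_R] under O. -/

import Mathlib

namespace DL

/-! ### Syntax of ALCQI concepts -/

/-- Roles: role names (indexed by ℕ) and inverse roles. -/
inductive Role where
  | name : ℕ → Role
  | inv  : ℕ → Role
deriving DecidableEq

/-- ALCQI concept expressions. -/
inductive Concept where
  | atom : ℕ → Concept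
  | top  : Concept
  | bot  : Concept
  | and  : Concept → Concept → Concept
  | or   : Concept → Concept → Concept
  | neg  : Concept → Concept
  | ex   : Role → Concept → Concept
  | all  : Role → Concept → Concept
  | atLeast : ℕ → Role → Concept → Concept
deriving DecidableEq

/-- The operators/constructors that a concept language may use. -/
inductive Op where
  | all | ex | ge | inv | and | or | top | bot | neg
deriving DecidableEq

/-! ### Interpretations and semantics -/

/-- An interpretation: a nonempty domain, interpretations of concept names
and of role names. -/
structure Interp where
  Δ : Type
  dom_nonempty : Nonempty Δ
  atom : ℕ → Set Δ
  rel : ℕ → Δ → Δ → Prop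

def Role.sem (I : Interp) : Role → (I.Δ → I.Δ → Prop)
  | .name R => I.rel R
  | .inv R  => fun d e => I.rel R e d

def Concept.sem (I : Interp) : Concept → Set I.Δ
  | .atom A => I.atom A
  | .top => Set.univ
  | .bot => ∅
  | .and C D => C.sem I ∩ D.sem I
  | .or C D => C.sem I ∪ D.sem I
  | .neg C => (C.sem I)ᶜ
  | .ex S C => {d | ∃ e, S.sem I d e ∧ e ∈ C.sem I}
  | .all S C => {d | ∀ e, S.sem I d e → e ∈ C.sem I}
  | .atLeast k S C => {d | ∃ s : Finset I.Δ, s.card = k ∧ ∀ e ∈ s, S.sem I d e ∧ e ∈ C.sem I}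

/-! ### Concept languages L(Os)[SC, SR] -/

def Role.inSig (Os : Finset Op) (SR : Finset ℕ) : Role → Prop
  | .name R => R ∈ SR
  | .inv R  => Op.inv ∈ Os ∧ R ∈ SR

/-- Membership of a concept in the language `L(Os)[SC, SR]`. -/
def Concept.inLang (Os : Finset Op) (SC SR : Finset ℕ) : Concept → Prop
  | .atom A => A ∈ SC
  | .top => Op.top ∈ Os
  | .bot => Op.bot ∈ Os
  | .and C D => Op.and ∈ Os ∧ C.inLang Os SC SR ∧ D.inLang Os SC SR
  | .or C D => Op.or ∈ Os ∧ C.inLang Os SC SR ∧ D.inLang Os SC SR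
  | .neg C => Op.neg ∈ Os ∧ C.inLang Os SC SR
  | .ex S C => Op.ex ∈ Os ∧ S.inSig Os SR ∧ C.inLang Os SC SR
  | .all S C => Op.all ∈ Os ∧ S.inSig Os SR ∧ C.inLang Os SC SR
  | .atLeast k S C => Op.ge ∈ Os ∧ 1 ≤ k ∧ S.inSig Os SR ∧ C.inLang Os SC SR

/-! ### DL-Lite ontologies -/

/-- Basic concepts: concept names, ∃R and ∃R⁻. -/
inductive Basic where
  | atom : ℕ → Basic
  | ex : Role → Basic
deriving DecidableEq

def Basic.sem (I : Interp) : Basic → Set I.Δ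
  | .atom A => I.atom A
  | .ex S => {d | ∃ e, S.sem I d e}

/-- A DL-Lite concept inclusion `B ⊑ C` where `C` is a basic concept
(`negated = false`) or a negated basic concept (`negated = true`). -/
structure CI where
  lhs : Basic
  rhs : Basic
  negated : Bool
deriving DecidableEq

def CI.sat (I : Interp) (ci : CI) : Prop :=
  if ci.negated then ci.lhs.sem I ⊆ (ci.rhs.sem I)ᶜ else ci.lhs.sem I ⊆ ci.rhs.sem I

/-- A DL-Lite ontology: a finite set (list) of concept inclusions. -/
abbrev Ontology := List CI

def Interp.satO (I : Interp) (Ont : Ontology) : Prop := ∀ ci ∈ Ont, ci.sat I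

/-! ### Pointed interpretations, examples, characterisations -/

structure PInterp where
  I : Interp
  pt : I.Δ

/-- A pointed interpretation is finite if its domain is finite. -/
def PInterp.finite (P : PInterp) : Prop := Finite P.I.Δ

/-- `C` fits a collection `(Epos, Eneg)` of labelled examples. -/
def Fits (C : Concept) (Epos Eneg : List PInterp) : Prop :=
  (∀ e ∈ Epos, e.pt ∈ C.sem e.I) ∧ (∀ e ∈ Eneg, e.pt ∉ C.sem e.I)

/-- Equivalence of concepts. -/
def CEquiv (C D : Concept) : Prop := ∀ I : Interp, C.sem I = D.sem I

/-- Equivalence of concepts relative to an ontology. -/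
def CEquivO (Ont : Ontology) (C D : Concept) : Prop :=
  ∀ I : Interp, I.satO Ont → C.sem I = D.sem I

/-- `⊨ C ⊑ D`. -/
def Subsumes (C D : Concept) : Prop := ∀ I : Interp, C.sem I ⊆ D.sem I

/-- `Ont ⊨ C ⊑ D`. -/
def SubsumesO (Ont : Ontology) (C D : Concept) : Prop :=
  ∀ I : Interp, I.satO Ont → C.sem I ⊆ D.sem I

/-- `(Epos, Eneg)` is a finite characterisation of `C` w.r.t. the
concept language (predicate) `L`: all examples are finite, `C` fits,
and every fitting concept of `L` is equivalent to `C`. -/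
def FinChar (L : Concept → Prop) (C : Concept) (Epos Eneg : List PInterp) : Prop :=
  (∀ e ∈ Epos ++ Eneg, e.finite) ∧
  Fits C Epos Eneg ∧
  ∀ D, L D → Fits D Epos Eneg → CEquiv C D

/-- Finite characterisation of `C` w.r.t. `L` under an ontology `Ont`:
all examples are finite and satisfy `Ont`, `C` fits, and every fitting
concept of `L` is equivalent to `C` relative to `Ont`. -/
def FinCharO (Ont : Ontology) (L : Concept → Prop) (C : Concept)
    (Epos Eneg : List PInterp) : Prop :=
  (∀ e ∈ Epos ++ Eneg, e.finite ∧ e.I.satO Ont) ∧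
  Fits C Epos Eneg ∧
  ∀ D, L D → Fits D Epos Eneg → CEquivO Ont C D

/-- `L(Os)` admits finite characterisations. -/
def AdmitsFinChar (Os : Finset Op) : Prop :=
  ∀ SC SR : Finset ℕ, ∀ C : Concept, C.inLang Os SC SR →
    ∃ Epos Eneg : List PInterp, FinChar (Concept.inLang Os SC SR) C Epos Eneg

/-- `L(Os)` admits finite characterisations under the ontology `Ont`. -/
def AdmitsFinCharO (Os : Finset Op) (Ont : Ontology) : Prop :=
  ∀ SC SR : Finset ℕ, ∀ C : Concept, C.inLang Os SC SR →
    ∃ Epos Eneg : List PInterp, FinCharO Ont (Concept.inLang Os SC SR) C Epos Eneg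

/-! ### Size, role depth, number restrictions -/

/-- Number of symbols of a concept expression (numbers in binary). -/
def Concept.size : Concept → ℕ
  | .atom _ => 1
  | .top => 1
  | .bot => 1
  | .and C D => C.size + D.size + 1
  | .or C D => C.size + D.size + 1
  | .neg C => C.size + 1
  | .ex _ C => C.size + 2
  | .all _ C => C.size + 2
  | .atLeast k _ C => C.size + 2 + Nat.size k

/-- Role depth of a concept. -/
def Concept.dp : Concept → ℕ
  | .atom _ => 0
  | .top => 0
  | .bot => 0
  | .and C D => max C.dp D.dp
  | .or C D => max C.dp D.dp
  | .neg C => C.dp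
  | .ex _ C => C.dp + 1
  | .all _ C => C.dp + 1
  | .atLeast _ _ C => C.dp + 1

/-- The largest number occurring in a number restriction of `C` (0 if none). -/
def Concept.nr : Concept → ℕ
  | .atom _ => 0
  | .top => 0
  | .bot => 0
  | .and C D => max C.nr D.nr
  | .or C D => max C.nr D.nr
  | .neg C => C.nr
  | .ex _ C => C.nr
  | .all _ C => C.nr
  | .atLeast k _ C => max k C.nr

/-! ### Preliminaries -/

/-- The operators of `L(∃,⊓,⊤,⊥)`. -/
abbrev elBot : Finset Op := {Op.ex, Op.and, Op.top, Op.bot}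

/-- Structural induction on the concepts of `L(∃,⊓,⊤,⊥)[SC, SR]`. -/
theorem elBot_induction {SC SR : Finset ℕ} {P : Concept → Prop}
    (atom : ∀ A ∈ SC, P (.atom A)) (top : P .top) (bot : P .bot)
    (and : ∀ C D, P C → P D → P (.and C D))
    (ex : ∀ R ∈ SR, ∀ C, P C → P (.ex (.name R) C)) :
    ∀ D : Concept, D.inLang elBot SC SR → P D
  | .atom A, h => atom A h
  | .top, _ => top
  | .bot, _ => bot
  | .and C D, h => and C D (elBot_induction atom top bot and ex C h.2.1)
      (elBot_induction atom top bot and ex D h.2.2)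
  | .or _ _, h => absurd h.1 (by decide)
  | .neg _, h => absurd h.1 (by decide)
  | .ex (.name R) C, h => ex R h.2.1 C (elBot_induction atom top bot and ex C h.2.2)
  | .ex (.inv _) _, h => absurd h.2.1.1 (by decide)
  | .all _ _, h => absurd h.1 (by decide)
  | .atLeast _ _ _, h => absurd h.1 (by decide)

/-- The subconcepts of a concept, as far as they are needed for `L(∃,⊓,⊤,⊥)`. -/
def Concept.subs : Concept → Finset Concept
  | .and C D => insert (.and C D) (C.subs ∪ D.subs)
  | .ex S C => insert (.ex S C) C.subs
  | C => {C}

theorem Concept.self_mem_subs (C : Concept) : C ∈ C.subs := by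
  cases C <;> simp [Concept.subs]

def Basic.toConcept : Basic → Concept
  | .atom A => .atom A
  | .ex S => .ex S .top

theorem Basic.sem_toConcept (I : Interp) (B : Basic) : B.toConcept.sem I = B.sem I := by
  cases B <;> simp [Basic.toConcept, Concept.sem, Basic.sem]

/-- The index of the concept or role name occurring in a basic concept. -/
def Basic.idx : Basic → ℕ
  | .atom A => A
  | .ex (.name R) => R
  | .ex (.inv R) => R

theorem exists_idx_bound (Ont : Ontology) (SC SR : Finset ℕ) :
    ∃ n, (∀ ci ∈ Ont, ci.lhs.idx < n ∧ ci.rhs.idx < n) ∧ (∀ A ∈ SC, A < n) ∧ ∀ R ∈ SR, R < n := by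
  obtain ⟨n, hn⟩ := (SC ∪ SR ∪ Ont.toFinset.image (fun ci => ci.lhs.idx) ∪
    Ont.toFinset.image (fun ci => ci.rhs.idx)).exists_nat_subset_range
  have key : ∀ {x}, x ∈ _ → x < n := fun hx => Finset.mem_range.1 (hn hx)
  refine ⟨n, fun ci hci => ⟨key ?_, key ?_⟩, fun A hA => key ?_, fun R hR => key ?_⟩
  · simp only [Finset.mem_union, Finset.mem_image, List.mem_toFinset]
    exact .inl (.inr ⟨ci, hci, rfl⟩)
  · simp only [Finset.mem_union, Finset.mem_image, List.mem_toFinset]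
    exact .inr ⟨ci, hci, rfl⟩
  · simp [hA]
  · simp [hR]

/-- An interpretation is a model of `Ont` if the basic concepts holding at each of its elements
are those shared by some nonempty family of pointed models of `Ont`. -/
theorem satO_of_forall_exists_family {Ont : Ontology} {n : ℕ}
    (hn : ∀ ci ∈ Ont, ci.lhs.idx < n ∧ ci.rhs.idx < n) (J : Interp)
    (h : ∀ x : J.Δ, ∃ S : Set PInterp, S.Nonempty ∧ (∀ P ∈ S, P.I.satO Ont) ∧
      ∀ B : Basic, B.idx < n → (x ∈ B.sem J ↔ ∀ P ∈ S, P.pt ∈ B.sem P.I)) :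
    J.satO Ont := by
  intro ci hci
  obtain ⟨hl, hr⟩ := hn ci hci
  cases hneg : ci.negated <;> simp only [CI.sat, hneg] <;> intro x hx <;>
    obtain ⟨S, ⟨P₀, hP₀⟩, hS, hB⟩ := h x
  · refine (hB _ hr).2 fun P hP => ?_
    have := hS P hP ci hci
    simp only [CI.sat, hneg] at this
    exact this ((hB _ hl).1 hx P hP)
  · intro hx'
    have := hS P₀ hP₀ ci hci
    simp only [CI.sat, hneg] at this
    exact this ((hB _ hl).1 hx P₀ hP₀) ((hB _ hr).1 hx' P₀ hP₀)

/-! ### The filtration of all models of an ontology -/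

/-- The `Γ`-type of an element of an interpretation. -/
def ctype (Γ : Finset Concept) (I : Interp) (d : I.Δ) : Set Concept :=
  {X | X ∈ Γ ∧ d ∈ X.sem I}

/-- The `Γ`-types realised in models of `Ont`. -/
def RealisedType (Ont : Ontology) (Γ : Finset Concept) : Type :=
  {t : Set Concept // ∃ I : Interp, I.satO Ont ∧ ∃ d : I.Δ, t = ctype Γ I d}

instance (Ont : Ontology) (Γ : Finset Concept) : Finite (RealisedType Ont Γ) := by
  have hfin : {t : Set Concept | t ⊆ (Γ : Set Concept)}.Finite := Γ.finite_toSet.finite_subsets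
  have hsub : {t : Set Concept | ∃ I : Interp, I.satO Ont ∧ ∃ d : I.Δ, t = ctype Γ I d} ⊆
      {t | t ⊆ (Γ : Set Concept)} := by
    rintro t ⟨I, -, d, rfl⟩ X hX
    exact hX.1
  exact (hfin.subset hsub).to_subtype

/-- The type of an element of a model, as a realised type. -/
def realise {Ont : Ontology} (Γ : Finset Concept) {I : Interp} (hI : I.satO Ont) (d : I.Δ) :
    RealisedType Ont Γ :=
  ⟨ctype Γ I d, I, hI, d, rfl⟩

/-- The filtration, through `Γ`, of the disjoint union of all models of `Ont`, with as many edges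
as possible. -/
def filtration (Ont : Ontology) (Γ : Finset Concept) (hne : Nonempty (RealisedType Ont Γ)) :
    Interp where
  Δ := RealisedType Ont Γ
  dom_nonempty := hne
  atom A := {t | .atom A ∈ t.1}
  rel R t t' := .ex (.name R) .top ∈ t.1 ∧ .ex (.inv R) .top ∈ t'.1 ∧
    ∀ F, .ex (.name R) F ∈ Γ → F ∈ t'.1 → .ex (.name R) F ∈ t.1

section Filtration

variable {Ont : Ontology} {Γ : Finset Concept} {hne : Nonempty (RealisedType Ont Γ)} {n : ℕ}

theorem filtration_rel_realise {R : ℕ} {I : Interp} (hI : I.satO Ont)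
    (h₁ : .ex (.name R) .top ∈ Γ) (h₂ : .ex (.inv R) .top ∈ Γ) {d e : I.Δ} (h : I.rel R d e) :
    (filtration Ont Γ hne).rel R (realise Γ hI d) (realise Γ hI e) :=
  ⟨⟨h₁, e, h, trivial⟩, ⟨h₂, d, h, trivial⟩, fun _ hF he => ⟨hF, e, h, he.2⟩⟩

theorem filtration_mem_basic (hΓ : ∀ B : Basic, B.idx < n → B.toConcept ∈ Γ) (B : Basic)
    (hB : B.idx < n) {I : Interp} (hI : I.satO Ont) (d : I.Δ) :
    (realise Γ hI d : (filtration Ont Γ hne).Δ) ∈ B.sem (filtration Ont Γ hne) ↔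
      d ∈ B.sem I := by
  rcases B with A | R | R
  · exact ⟨fun h => h.2, fun h => ⟨hΓ (.atom A) hB, h⟩⟩
  · constructor
    · rintro ⟨t, h, -⟩
      obtain ⟨e, h, -⟩ := h.2
      exact ⟨e, h⟩
    · rintro ⟨e, h⟩
      exact ⟨realise Γ hI e,
        filtration_rel_realise hI (hΓ (.ex (.name R)) hB) (hΓ (.ex (.inv R)) hB) h⟩
  · constructor
    · rintro ⟨t, -, h, -⟩
      obtain ⟨e, h, -⟩ := h.2
      exact ⟨e, h⟩
    · rintro ⟨e, h⟩
      exact ⟨realise Γ hI e,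
        filtration_rel_realise hI (hΓ (.ex (.name R)) hB) (hΓ (.ex (.inv R)) hB) h⟩

theorem filtration_satO (hn : ∀ ci ∈ Ont, ci.lhs.idx < n ∧ ci.rhs.idx < n)
    (hΓ : ∀ B : Basic, B.idx < n → B.toConcept ∈ Γ) : (filtration Ont Γ hne).satO Ont := by
  refine satO_of_forall_exists_family hn _ ?_
  rintro ⟨t, I, hI, d, rfl⟩
  refine ⟨{⟨I, d⟩}, Set.singleton_nonempty _, by simpa using hI, fun B hB => ?_⟩
  simp only [Set.mem_singleton_iff, forall_eq]
  exact filtration_mem_basic hΓ B hB hI d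

/-- Concepts are preserved when passing from a model to the filtration. -/
theorem realise_mem_of_mem {SC SR : Finset ℕ} (hSC : ∀ A ∈ SC, A < n) (hSR : ∀ R ∈ SR, R < n)
    (hΓ : ∀ B : Basic, B.idx < n → B.toConcept ∈ Γ) {I : Interp} (hI : I.satO Ont) (D : Concept)
    (hD : D.inLang elBot SC SR) : ∀ d : I.Δ, d ∈ D.sem I →
      (realise Γ hI d : (filtration Ont Γ hne).Δ) ∈ D.sem (filtration Ont Γ hne) := by
  refine elBot_induction (SC := SC) (SR := SR) (P := fun D => ∀ d : I.Δ, d ∈ D.sem I →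
      (realise Γ hI d : (filtration Ont Γ hne).Δ) ∈ D.sem (filtration Ont Γ hne))
    ?_ ?_ ?_ ?_ ?_ D hD
  · exact fun A hA d hd => ⟨hΓ (.atom A) (hSC A hA), hd⟩
  · exact fun _ _ => trivial
  · exact fun _ h => h.elim
  · exact fun C D hC hD d hd => ⟨hC d hd.1, hD d hd.2⟩
  · rintro R hR C hC d ⟨e, h, he⟩
    exact ⟨realise Γ hI e, filtration_rel_realise hI (hΓ (.ex (.name R)) (hSR R hR))
      (hΓ (.ex (.inv R)) (hSR R hR)) h, hC e he⟩

/-- Concepts with all subconcepts in `Γ` are reflected by the filtration. -/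
theorem mem_type_of_mem_filtration {SC SR : Finset ℕ} (E : Concept)
    (hE : E.inLang elBot SC SR) : E.subs ⊆ Γ → ∀ t : RealisedType Ont Γ,
      (t : (filtration Ont Γ hne).Δ) ∈ E.sem (filtration Ont Γ hne) → E ∈ t.1 := by
  refine elBot_induction (SC := SC) (SR := SR) (P := fun E => E.subs ⊆ Γ →
      ∀ t : RealisedType Ont Γ,
        (t : (filtration Ont Γ hne).Δ) ∈ E.sem (filtration Ont Γ hne) → E ∈ t.1)
    ?_ ?_ ?_ ?_ ?_ E hE
  · exact fun A _ _ t h => h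
  · rintro hΓ ⟨t, I, hI, d, rfl⟩ -
    exact ⟨hΓ (Concept.self_mem_subs _), trivial⟩
  · exact fun _ _ h => h.elim
  · rintro C D hC hD hΓ ⟨t, I, hI, d, rfl⟩ ⟨h₁, h₂⟩
    have hC' := hC (fun x hx => hΓ (by simp [Concept.subs, hx])) _ h₁
    have hD' := hD (fun x hx => hΓ (by simp [Concept.subs, hx])) _ h₂
    exact ⟨hΓ (Concept.self_mem_subs _), hC'.2, hD'.2⟩
  · rintro R _ C hC hΓ t ⟨t', h, ht'⟩
    exact h.2.2 C (hΓ (Concept.self_mem_subs _))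
      (hC (fun x hx => hΓ (by simp [Concept.subs, hx])) t' ht')

end Filtration

/-- Finitely many finite pointed models of `Ont` outside `C` suffice to refute every concept that
is not subsumed by `C`. -/
theorem exists_negative_examples (Ont : Ontology) {SC SR : Finset ℕ} {C : Concept}
    (hC : C.inLang elBot SC SR) :
    ∃ Eneg : List PInterp, (∀ e ∈ Eneg, e.finite ∧ e.I.satO Ont) ∧
      (∀ e ∈ Eneg, e.pt ∉ C.sem e.I) ∧
      ∀ D : Concept, D.inLang elBot SC SR → (∀ e ∈ Eneg, e.pt ∉ D.sem e.I) →
        SubsumesO Ont D C := by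
  classical
  by_cases hsat : ∃ I : Interp, I.satO Ont
  swap
  · exact ⟨[], by simp, by simp, fun D _ _ I hI => (hsat ⟨I, hI⟩).elim⟩
  obtain ⟨n, hn, hSC, hSR⟩ := exists_idx_bound Ont SC SR
  let Γ : Finset Concept := C.subs ∪ (Finset.range n).image .atom ∪
    (Finset.range n).image (fun R => .ex (.name R) .top) ∪
    (Finset.range n).image (fun R => .ex (.inv R) .top)
  have hΓ : ∀ B : Basic, B.idx < n → B.toConcept ∈ Γ := by
    rintro (A | R | R) hB <;> simp only [Basic.idx] at hB <;> simp [Γ, Basic.toConcept, hB]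
  have hCΓ : C.subs ⊆ Γ := fun x hx => by simp [Γ, hx]
  have hne : Nonempty (RealisedType Ont Γ) := by
    obtain ⟨I, hI⟩ := hsat
    obtain ⟨d⟩ := I.dom_nonempty
    exact ⟨realise Γ hI d⟩
  have hfin : {t : RealisedType Ont Γ | C ∉ t.1}.Finite := Set.toFinite _
  refine ⟨hfin.toFinset.toList.map fun t => ⟨filtration Ont Γ hne, t⟩, ?_, ?_, ?_⟩
  · intro e he
    obtain ⟨t, -, rfl⟩ := List.mem_map.1 he
    exact ⟨inferInstanceAs (Finite (RealisedType Ont Γ)), filtration_satO hn hΓ⟩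
  · intro e he
    obtain ⟨t, ht, rfl⟩ := List.mem_map.1 he
    have ht : C ∉ t.1 := hfin.mem_toFinset.1 (Finset.mem_toList.1 ht)
    exact fun h => ht (mem_type_of_mem_filtration C hC hCΓ t h)
  · intro D hD hfit I hI d hd
    by_contra hdC
    refine hfit ⟨filtration Ont Γ hne, realise Γ hI d⟩ (List.mem_map.2 ⟨_, ?_, rfl⟩)
      (realise_mem_of_mem hSC hSR hΓ hI D hD d hd)
    exact Finset.mem_toList.2 (hfin.mem_toFinset.2 fun h => hdC h.2)

/-! ### Finite canonical models -/

/-- The instances of `N.2` that are moreover successors along the role `N.1`, if there is one. -/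
def nodeSem (I : Interp) : Option Role × Concept → Set I.Δ
  | (none, E) => E.sem I
  | (some S, E) => {e | e ∈ E.sem I ∧ ∃ d, S.sem I d e}

/-- The pointed models of `Ont` realising a node. -/
def nodeModels (Ont : Ontology) (N : Option Role × Concept) : Set PInterp :=
  {P | P.I.satO Ont ∧ P.pt ∈ nodeSem P.I N}

/-- The interpretation whose elements are the nodes in `X` satisfiable under `Ont`, where atoms
and successors are those entailed by `Ont`, together with the required predecessors. -/
def canonical (Ont : Ontology) (X : Finset (Option Role × Concept))
    (hne : ∃ N ∈ X, (nodeModels Ont N).Nonempty) : Interp where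
  Δ := {N // N ∈ X ∧ (nodeModels Ont N).Nonempty}
  dom_nonempty := let ⟨N, h⟩ := hne; ⟨N, h⟩
  atom A := {N | ∀ P ∈ nodeModels Ont N.1, P.pt ∈ P.I.atom A}
  rel R N N' :=
    (∃ F, N'.1 = (some (.name R), F) ∧
      ∀ P ∈ nodeModels Ont N.1, P.pt ∈ (Concept.ex (.name R) F).sem P.I) ∨
    (N.1 = (some (.inv R), .top) ∧
      ∀ P ∈ nodeModels Ont N'.1, P.pt ∈ (Basic.ex (.inv R)).sem P.I)

section Canonical

variable {Ont : Ontology} {X : Finset (Option Role × Concept)}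
  {hne : ∃ N ∈ X, (nodeModels Ont N).Nonempty} {n : ℕ}

theorem canonical_mem_basic
    (hX : ∀ R < n, (some (.name R), .top) ∈ X ∧ (some (.inv R), .top) ∈ X)
    (B : Basic) (hB : B.idx < n) (N : (canonical Ont X hne).Δ) :
    N ∈ B.sem (canonical Ont X hne) ↔ ∀ P ∈ nodeModels Ont N.1, P.pt ∈ B.sem P.I := by
  obtain ⟨N, hN, P₀, hP₀⟩ := N
  rcases B with A | R | R
  · exact Iff.rfl
  · constructor
    · rintro ⟨N', ⟨F, -, h⟩ | ⟨h, -⟩⟩ P hP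
      · obtain ⟨e, he, -⟩ := h P hP
        exact ⟨e, he⟩
      · dsimp only at h hP
        subst h
        exact hP.2.2
    · intro h
      obtain ⟨e, he⟩ := h P₀ hP₀
      refine ⟨⟨(some (.name R), .top), (hX R hB).1, ⟨P₀.I, e⟩, hP₀.1, trivial, P₀.pt, he⟩,
        .inl ⟨.top, rfl, fun P hP => ?_⟩⟩
      obtain ⟨e, he⟩ := h P hP
      exact ⟨e, he, trivial⟩
  · constructor
    · rintro ⟨N', ⟨F, h, -⟩ | ⟨-, h⟩⟩ P hP
      · dsimp only at h hP
        subst h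
        exact hP.2.2
      · exact h P hP
    · intro h
      obtain ⟨e, he⟩ := h P₀ hP₀
      exact ⟨⟨(some (.inv R), .top), (hX R hB).2, ⟨P₀.I, e⟩, hP₀.1, trivial, P₀.pt, he⟩,
        .inr ⟨rfl, h⟩⟩

theorem canonical_satO (hn : ∀ ci ∈ Ont, ci.lhs.idx < n ∧ ci.rhs.idx < n)
    (hX : ∀ R < n, (some (.name R), .top) ∈ X ∧ (some (.inv R), .top) ∈ X) :
    (canonical Ont X hne).satO Ont :=
  satO_of_forall_exists_family hn _ fun N =>
    ⟨nodeModels Ont N.1, N.2.2, fun _ hP => hP.1, fun B hB => canonical_mem_basic hX B hB N⟩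

/-- Entailed concepts hold in the canonical model. -/
theorem mem_canonical_of_entailed {SC SR : Finset ℕ} (E : Concept)
    (hE : E.inLang elBot SC SR) :
    (∀ R ∈ SR, ∀ F ∈ E.subs, (some (.name R), F) ∈ X) → ∀ N : (canonical Ont X hne).Δ,
      (∀ P ∈ nodeModels Ont N.1, P.pt ∈ E.sem P.I) → N ∈ E.sem (canonical Ont X hne) := by
  refine elBot_induction (SC := SC) (SR := SR) (P := fun E =>
    (∀ R ∈ SR, ∀ F ∈ E.subs, (some (.name R), F) ∈ X) → ∀ N : (canonical Ont X hne).Δ,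
      (∀ P ∈ nodeModels Ont N.1, P.pt ∈ E.sem P.I) → N ∈ E.sem (canonical Ont X hne))
    ?_ ?_ ?_ ?_ ?_ E hE
  · exact fun A _ _ N h => h
  · exact fun _ _ _ => trivial
  · intro _ N h
    obtain ⟨P, hP⟩ := N.2.2
    exact (h P hP).elim
  · intro C D hC hD hX N h
    exact ⟨hC (fun R hR F hF => hX R hR F (by simp [Concept.subs, hF])) N fun P hP => (h P hP).1,
      hD (fun R hR F hF => hX R hR F (by simp [Concept.subs, hF])) N fun P hP => (h P hP).2⟩
  · intro R hR C hC hX N h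
    have hX' : ∀ R ∈ SR, ∀ F ∈ C.subs, (some (.name R), F) ∈ X :=
      fun R hR F hF => hX R hR F (by simp [Concept.subs, hF])
    obtain ⟨P, hP⟩ := N.2.2
    obtain ⟨e, he, heC⟩ := h P hP
    exact ⟨⟨(some (.name R), C), hX' R hR C C.self_mem_subs, ⟨P.I, e⟩, hP.1, heC, P.pt, he⟩,
      .inl ⟨C, rfl, h⟩, hC hX' _ fun Q hQ => hQ.2.1⟩

/-- Concepts holding at a node that is not a predecessor node are entailed. -/
theorem entailed_of_mem_canonical {SC SR : Finset ℕ} (D : Concept)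
    (hD : D.inLang elBot SC SR) :
    ∀ N : (canonical Ont X hne).Δ, (∀ R, N.1.1 ≠ some (.inv R)) →
      N ∈ D.sem (canonical Ont X hne) → ∀ P ∈ nodeModels Ont N.1, P.pt ∈ D.sem P.I := by
  refine elBot_induction (SC := SC) (SR := SR) (P := fun D =>
    ∀ N : (canonical Ont X hne).Δ, (∀ R, N.1.1 ≠ some (.inv R)) →
      N ∈ D.sem (canonical Ont X hne) → ∀ P ∈ nodeModels Ont N.1, P.pt ∈ D.sem P.I)
    ?_ ?_ ?_ ?_ ?_ D hD
  · exact fun A _ N _ h => h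
  · exact fun _ _ _ _ _ => trivial
  · exact fun _ _ h => h.elim
  · exact fun C D hC hD N hN h P hP => ⟨hC N hN h.1 P hP, hD N hN h.2 P hP⟩
  · rintro R _ C hC N hN ⟨N', ⟨F, hN', h⟩ | ⟨h, -⟩, hN'C⟩ P hP
    · obtain ⟨e, he, heF⟩ := h P hP
      refine ⟨e, he, hC N' (by simp [hN']) hN'C ⟨P.I, e⟩ ?_⟩
      rw [hN']
      exact ⟨hP.1, heF, P.pt, he⟩
    · exact (hN R (by rw [h])).elim

end Canonical

/-- Finitely many finite pointed models of `Ont` inside `C` suffice to refute every concept that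
does not subsume `C`. -/
theorem exists_positive_examples (Ont : Ontology) {SC SR : Finset ℕ} {C : Concept}
    (hC : C.inLang elBot SC SR) :
    ∃ Epos : List PInterp, (∀ e ∈ Epos, e.finite ∧ e.I.satO Ont) ∧
      (∀ e ∈ Epos, e.pt ∈ C.sem e.I) ∧
      ∀ D : Concept, D.inLang elBot SC SR → (∀ e ∈ Epos, e.pt ∈ D.sem e.I) →
        SubsumesO Ont C D := by
  by_cases hsat : (nodeModels Ont (none, C)).Nonempty
  swap
  · exact ⟨[], by simp, by simp, fun D _ _ I hI d hd => (hsat ⟨⟨I, d⟩, hI, hd⟩).elim⟩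
  obtain ⟨n, hn, -, hSR⟩ := exists_idx_bound Ont SC SR
  let X : Finset (Option Role × Concept) :=
    (insert none ((Finset.range n).image (some ∘ .name) ∪ (Finset.range n).image (some ∘ .inv))) ×ˢ
      insert .top C.subs
  have hX : ∀ R < n, (some (.name R), .top) ∈ X ∧ (some (.inv R), .top) ∈ X :=
    fun R hR => by simp [X, hR]
  have hXC : ∀ R ∈ SR, ∀ F ∈ C.subs, (some (.name R), F) ∈ X :=
    fun R hR F hF => by simp [X, hSR R hR, hF]
  have hroot : (none, C) ∈ X := by simp [X, C.self_mem_subs]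
  have hne : ∃ N ∈ X, (nodeModels Ont N).Nonempty := ⟨_, hroot, hsat⟩
  let root : (canonical Ont X hne).Δ := ⟨(none, C), hroot, hsat⟩
  refine ⟨[⟨canonical Ont X hne, root⟩], ?_, ?_, ?_⟩
  · simp only [List.mem_singleton, forall_eq]
    exact ⟨(X.finite_toSet.subset fun N hN => hN.1 :
      {N | N ∈ X ∧ (nodeModels Ont N).Nonempty}.Finite).to_subtype, canonical_satO hn hX⟩
  · simp only [List.mem_singleton, forall_eq]
    exact mem_canonical_of_entailed C hC hXC root fun P hP => hP.2
  · simp only [List.mem_singleton, forall_eq]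
    exact fun D hD h I hI d hd =>
      entailed_of_mem_canonical D hD root (by simp [root]) h ⟨I, d⟩ ⟨hI, hd⟩

/-- **Theorem**: `L(∃,⊓,⊤,⊥)` admits finite characterisations under every
DL-Lite ontology. -/
theorem ELbot_admits_finchar_under_DLLite (Ont : Ontology) :
    AdmitsFinCharO ({Op.ex, Op.and, Op.top, Op.bot} : Finset Op) Ont := by
  intro SC SR C hC
  obtain ⟨Epos, hpos, hposC, hposD⟩ := exists_positive_examples Ont hC
  obtain ⟨Eneg, hneg, hnegC, hnegD⟩ := exists_negative_examples Ont hC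
  refine ⟨Epos, Eneg, fun e he => ?_, ⟨hposC, hnegC⟩, fun D hD hfit I hI => ?_⟩
  · exact (List.mem_append.1 he).elim (hpos e) (hneg e)
  · exact (hposD D hD hfit.1 I hI).antisymm (hnegD D hD hfit.2 I hI)

end DL
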